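/- For every α > 0 and λ > 0 there exist R > 0 and c > 0 such that I_α(u) ≥ c for all u ∈ W₀^{1,p}(Ω) with ‖u‖ = R. -/

import Mathlib

open MeasureTheory Real Filter Metric Set Topology
open scoped Topology ENNReal NNReal RealInnerProductSpace

noncomputable section

/-- Euclidean space `ℝ^N`. -/
abbrev Eu (N : ℕ) : Type := EuclideanSpace ℝ (Fin N)

/-- `φ` is a `C₀^∞` test function supported in `U`. -/
def IsTestFun {N : ℕ} (U : Set (Eu N)) (φ : Eu N → ℝ) : Prop :=
  ContDiff ℝ (⊤ : ℕ∞) φ ∧ HasCompactSupport φ ∧ tsupport φ ⊆ U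

/-- The weak form of `-Δ_p u` tested against `φ` on `Ω`: `∫_Ω |∇u|^{p-2} ∇u · ∇φ dx`. -/
def pLap {N : ℕ} (Ω : Set (Eu N)) (p : ℝ) (u φ : Eu N → ℝ) : ℝ :=
  ∫ x in Ω, ‖gradient u x‖ ^ (p - 2) * ⟪gradient u x, gradient φ x⟫

/-- Standing exponent assumptions: `N ≥ 2`, `1 < p ≤ q - 1` and `q < p* = Np/(N-p)`. -/
def ExponentsOK (N : ℕ) (p q : ℝ) : Prop :=
  2 ≤ N ∧ 1 < p ∧ p ≤ q - 1 ∧ p < N ∧ q < N * p / (N - p)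

/-- The smooth bump `g : ℝ → [0,2]`, vanishing outside `(0,1)`, with `∫₀¹ g = 1`. -/
def IsCutoff (g : ℝ → ℝ) : Prop :=
  ContDiff ℝ (⊤ : ℕ∞) g ∧ (∀ t, 0 ≤ g t ∧ g t ≤ 2) ∧ (∀ t, t ∉ Set.Ioo (0:ℝ) 1 → g t = 0) ∧
    (∫ t in (0:ℝ)..1, g t) = 1

/-- Membership in `W₀^{1,p}(Ω)`: a (differentiable representative of a) function
vanishing outside `Ω`, with `p`-integrable gradient. -/
def MemW01p {N : ℕ} (Ω : Set (Eu N)) (p : ℝ) (u : Eu N → ℝ) : Prop :=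
  Differentiable ℝ u ∧ (∀ x ∉ Ω, u x = 0) ∧
    IntegrableOn (fun x => ‖gradient u x‖ ^ p) Ω volume

/-- The `W₀^{1,p}(Ω)` norm `‖u‖ = ‖∇u‖_{L^p(Ω)}`. -/
def wnorm {N : ℕ} (Ω : Set (Eu N)) (p : ℝ) (u : Eu N → ℝ) : ℝ :=
  (∫ x in Ω, ‖gradient u x‖ ^ p) ^ (1/p)

/-- The approximating functional
`I_α(u) = ∫_Ω |∇u|^p/p dx + ∫_Ω G((u-1)/α) dx - λ ∫_Ω (u-1)_+^q/q dx`. -/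
def Ifun {N : ℕ} (Ω : Set (Eu N)) (p q lam α : ℝ) (G : ℝ → ℝ) (u : Eu N → ℝ) : ℝ :=
  (∫ x in Ω, ‖gradient u x‖ ^ p / p) + (∫ x in Ω, G ((u x - 1) / α))
    - lam * ∫ x in Ω, (max (u x - 1) 0) ^ q / q

/-- A critical point of `I_α`: a weak solution of
`-Δ_p u = -α⁻¹ g((u-1)/α) + λ (u-1)_+^{q-1}` in `Ω`. -/
def IsCritPt {N : ℕ} (Ω : Set (Eu N)) (p q lam α : ℝ) (g : ℝ → ℝ) (u : Eu N → ℝ) : Prop :=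
  ∀ φ : Eu N → ℝ, IsTestFun Ω φ →
    pLap Ω p u φ
      = ∫ x in Ω, (-(1/α) * g ((u x - 1) / α) + lam * (max (u x - 1) 0) ^ (q - 1)) * φ x

/-- A differentiable function on the line vanishing off a bounded below open set `U` is bounded by
the integral over `U` of its derivative. -/
theorem enorm_le_setLIntegral_deriv {w : ℝ → ℝ} {U : Set ℝ} (hU : IsOpen U) (hb : BddBelow U)
    (hw : Differentiable ℝ w) (h0 : ∀ t ∉ U, w t = 0) (x : ℝ) :
    ‖w x‖ₑ ≤ ∫⁻ t in U, ‖deriv w t‖ₑ := by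
  by_cases htop : ∫⁻ t in U, ‖deriv w t‖ₑ = ⊤
  · simp [htop]
  by_cases hx : x ∈ U
  swap
  · simp [h0 x hx]
  have hint : IntegrableOn (deriv w) U :=
    ⟨(measurable_deriv w).aestronglyMeasurable, lt_top_iff_ne_top.2 htop⟩
  obtain ⟨b, hb⟩ := hb
  set S : Set ℝ := Uᶜ ∩ Iic x with hS
  have hSc : IsClosed S := hU.isClosed_compl.inter isClosed_Iic
  have hSn : S.Nonempty := by
    refine ⟨b - 1, fun h => ?_, ?_⟩
    · linarith [hb h]
    · have := hb hx
      simp only [mem_Iic]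
      linarith
  have hSb : BddAbove S := ⟨x, fun t ht => ht.2⟩
  have haS : sSup S ∈ S := hSc.csSup_mem hSn hSb
  set a := sSup S with ha
  have hax : a ≤ x := haS.2
  have hsub : Ioc a x ⊆ U := by
    intro t ht
    by_contra htU
    exact absurd (le_csSup hSb (show t ∈ S from ⟨htU, ht.2⟩)) (not_le.2 ht.1)
  have hFTC : ∫ t in a..x, deriv w t = w x := by
    rw [intervalIntegral.integral_deriv_eq_sub (fun t _ => hw t), h0 a haS.1, sub_zero]
    rw [intervalIntegrable_iff_integrableOn_Ioc_of_le hax]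
    exact hint.mono_set hsub
  rw [← hFTC, intervalIntegral.integral_of_le hax]
  exact (enorm_integral_le_lintegral_enorm _).trans (lintegral_mono_set hsub)

/-- The **Gagliardo-Nirenberg-Sobolev inequality** with exponent one, for functions which are merely
differentiable and vanish off a bounded open set. -/
theorem lintegral_rpow_le_rpow_setLIntegral_fderiv {N : ℕ} {r : ℝ} (hr : (N : ℝ).HolderConjugate r)
    {Ω : Set (Eu N)} (hΩo : IsOpen Ω) (hΩb : Bornology.IsBounded Ω) {v : Eu N → ℝ}
    (hv : Differentiable ℝ v) (h0 : ∀ x ∉ Ω, v x = 0) :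
    ∫⁻ x, ‖v x‖ₑ ^ r ≤ (∫⁻ x in Ω, ‖fderiv ℝ v x‖ₑ) ^ r := by
  have hN : (1 : ℝ) < N := hr.lt
  set F : Eu N → ℝ≥0∞ := Ω.indicator fun x => ‖fderiv ℝ v x‖ₑ with hF
  have hFm : Measurable F := (measurable_fderiv ℝ v).enorm.indicator hΩo.measurableSet
  have hmp := PiLp.volume_preserving_toLp (Fin N)
  have hr' : Real.HolderConjugate (Fintype.card (Fin N)) r := by simpa using hr
  have hgrid := lintegral_prod_lintegral_pow_le (fun _ : Fin N => (volume : Measure ℝ)) hr'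
    (hFm.comp hmp.measurable)
  rw [← lintegral_indicator hΩo.measurableSet, ← hmp.lintegral_comp hFm,
    ← hmp.lintegral_comp (by have := hv.continuous.measurable; fun_prop)]
  refine le_trans (lintegral_mono fun y => ?_) hgrid
  have hcard : ‖v (WithLp.toLp 2 y)‖ₑ ^ r
      = ∏ _i : Fin N, ‖v (WithLp.toLp 2 y)‖ₑ ^ (1 / ((Fintype.card (Fin N) : ℝ) - 1)) := by
    rw [Finset.prod_const, Finset.card_univ, Fintype.card_fin, ← ENNReal.rpow_natCast,
      ← ENNReal.rpow_mul, hr.conjugate_eq]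
    congr 1
    field_simp
  rw [hcard]
  gcongr with i
  · simp only [Fintype.card_fin]
    have : (0 : ℝ) < N - 1 := by linarith
    positivity
  have hL : ∀ t, HasDerivAt (fun t => (WithLp.toLp 2 (Function.update y i t) : Eu N))
      (EuclideanSpace.single i (1 : ℝ)) t := by
    intro t
    have h1 := (PiLp.continuousLinearEquiv 2 ℝ (fun _ : Fin N => ℝ)).symm.hasFDerivAt
      (x := Function.update y i t) |>.comp_hasDerivAt t (hasDerivAt_update y i t)
    exact h1
  set ℓ : ℝ → Eu N := fun t => WithLp.toLp 2 (Function.update y i t) with hℓ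
  have hℓc : Continuous ℓ := continuous_iff_continuousAt.2 fun t => (hL t).continuousAt
  have hU : IsOpen (ℓ ⁻¹' Ω) := hΩo.preimage hℓc
  have hUb : BddBelow (ℓ ⁻¹' Ω) := by
    obtain ⟨C, hC⟩ := hΩb.exists_norm_le
    refine ⟨-C, fun t ht => ?_⟩
    have h1 := (PiLp.norm_apply_le (ℓ t) i).trans (hC _ ht)
    have h2 : (ℓ t) i = t := by simp [hℓ]
    rw [h2] at h1
    exact (abs_le.1 h1).1
  have hw : ∀ t, HasDerivAt (v ∘ ℓ) (fderiv ℝ v (ℓ t) (EuclideanSpace.single i (1 : ℝ))) t :=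
    fun t => (hv (ℓ t)).hasFDerivAt.comp_hasDerivAt t (hL t)
  have h1 := enorm_le_setLIntegral_deriv hU hUb (fun t => (hw t).differentiableAt)
    (fun t ht => h0 _ ht) (y i)
  have h2 : (v ∘ ℓ) (y i) = v (WithLp.toLp 2 y) := by simp [hℓ]
  rw [h2] at h1
  refine h1.trans ?_
  rw [← lintegral_indicator hU.measurableSet]
  refine lintegral_mono fun t => ?_
  by_cases ht : ℓ t ∈ Ω
  · have ht' : t ∈ ℓ ⁻¹' Ω := ht
    have hgoal : F (ℓ t) = ‖fderiv ℝ v (ℓ t)‖ₑ := by simp [hF, ht]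
    rw [indicator_of_mem ht', (hw t).deriv]
    refine le_trans ?_ hgoal.ge
    refine (ContinuousLinearMap.le_opENorm _ _).trans ?_
    simp [enorm_eq_nnnorm]
  · have ht' : t ∉ ℓ ⁻¹' Ω := ht
    rw [indicator_of_notMem ht']
    exact zero_le

/-- The **Sobolev inequality** with critical exponent `Np/(N-p)` for differentiable functions
vanishing off a bounded open set. -/
theorem exists_sobolev_const {N : ℕ} (hN : 2 ≤ N) {p : ℝ} (hp : 1 < p) (hpN : p < N) :
    ∃ K : ℝ≥0∞, K ≠ ⊤ ∧ ∀ (Ω : Set (Eu N)), IsOpen Ω → Bornology.IsBounded Ω →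
      ∀ u : Eu N → ℝ, Differentiable ℝ u → (∀ x ∉ Ω, u x = 0) →
      ∫⁻ x, ‖u x‖ₑ ^ (N * p / (N - p)) ≠ ⊤ ∧
      ∫⁻ x, ‖u x‖ₑ ^ (N * p / (N - p))
        ≤ K * (∫⁻ x in Ω, ‖fderiv ℝ u x‖ₑ ^ p) ^ (N / (N - p)) := by
  have hN' : (2 : ℝ) ≤ N := by exact_mod_cast hN
  have hNp : (0 : ℝ) < N - p := by linarith
  have hN1 : (0 : ℝ) < N - 1 := by linarith
  have hp1 : 0 < p - 1 := by linarith
  set s : ℝ := N * p / (N - p) with hs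
  have hs0 : 0 < s := by positivity
  set γ : ℝ := p * (N - 1) / (N - p) with hγ
  have hγ1 : 1 < γ := by
    rw [hγ, lt_div_iff₀ hNp]
    nlinarith
  set r : ℝ := N / (N - 1) with hr
  have hr0 : 0 < r := by positivity
  have hrc : (N : ℝ).HolderConjugate r := (Real.holderConjugate_iff_eq_conjExponent (by linarith)).2 hr
  set p' : ℝ := p / (p - 1) with hp'
  have hp'0 : 0 < p' := by positivity
  have hpc : p'.HolderConjugate p := ((Real.holderConjugate_iff_eq_conjExponent hp).2 hp').symm
  refine ⟨(ENNReal.ofReal γ ^ r) ^ γ, by finiteness, ?_⟩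
  intro Ω hΩo hΩb u hu h0
  set A := ∫⁻ x, ‖u x‖ₑ ^ s with hA
  set B := ∫⁻ x in Ω, ‖fderiv ℝ u x‖ₑ ^ p with hB
  have hcs : HasCompactSupport u := by
    refine HasCompactSupport.intro hΩb.isCompact_closure fun x hx => h0 x fun h => hx (subset_closure h)
  have hAtop : A ≠ ⊤ := by
    have h1 : HasCompactSupport fun x => |u x| ^ s :=
      hcs.comp_left (g := fun t => |t| ^ s) (by simp [hs0.ne'])
    have h2 : Continuous fun x => |u x| ^ s :=
      hu.continuous.abs.rpow_const fun x => Or.inr hs0.le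
    have h3 := (h2.integrable_of_hasCompactSupport h1 (μ := volume)).2
    have h4 : A = ∫⁻ x, ‖|u x| ^ s‖ₑ := by
      refine lintegral_congr fun x => ?_
      rw [Real.enorm_rpow_of_nonneg (abs_nonneg _) hs0.le, enorm_abs]
    rw [h4]
    exact h3.ne
  refine ⟨hAtop, ?_⟩
  by_cases hA0 : A = 0
  · simp [hA0]
  have hGNS := lintegral_rpow_le_rpow_setLIntegral_fderiv hrc hΩo hΩb (hu.norm_rpow hγ1)
    (fun x hx => by simp [h0 x hx, (by linarith : γ ≠ 0)])
  have hL : ∫⁻ x, ‖‖u x‖ ^ γ‖ₑ ^ r = A := by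
    refine lintegral_congr fun x => ?_
    rw [Real.enorm_rpow_of_nonneg (norm_nonneg _) (by linarith), enorm_norm, ← ENNReal.rpow_mul]
    congr 1
    rw [hγ, hr, hs]
    field_simp
  rw [hL] at hGNS
  have hpt : ∀ x, ‖fderiv ℝ (fun x => ‖u x‖ ^ γ) x‖ₑ
      ≤ ENNReal.ofReal γ * (‖u x‖ₑ ^ (γ - 1) * ‖fderiv ℝ u x‖ₑ) := by
    intro x
    have h := enorm_fderiv_norm_rpow_le hu (x := x) (p := NNReal.mk γ (by linarith)) hγ1
    rw [mul_assoc] at h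
    refine h.trans_eq ?_
    congr 1
    rw [ENNReal.ofReal_eq_coe_nnreal (by linarith)]
  have hHolder : ∫⁻ x in Ω, ‖u x‖ₑ ^ (γ - 1) * ‖fderiv ℝ u x‖ₑ
      ≤ A ^ (1 / p') * B ^ (1 / p) := by
    have hum := hu.continuous.measurable
    have h := ENNReal.lintegral_mul_le_Lp_mul_Lq (volume.restrict Ω) hpc
      (f := fun x => ‖u x‖ₑ ^ (γ - 1)) (g := fun x => ‖fderiv ℝ u x‖ₑ)
      (by fun_prop) (measurable_fderiv ℝ u).enorm.aemeasurable
    refine h.trans ?_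
    gcongr
    refine (setLIntegral_le_lintegral _ _).trans_eq ?_
    refine lintegral_congr fun x => ?_
    rw [← ENNReal.rpow_mul]
    congr 1
    rw [hγ, hp', hs]
    field_simp
    ring
  have hmain : A ≤ (ENNReal.ofReal γ * (A ^ (1 / p') * B ^ (1 / p))) ^ r := by
    refine hGNS.trans ?_
    gcongr
    refine (lintegral_mono hpt).trans ?_
    rw [lintegral_const_mul' _ _ (by finiteness)]
    gcongr
  rw [ENNReal.mul_rpow_of_nonneg _ _ hr0.le, ENNReal.mul_rpow_of_nonneg _ _ hr0.le,
    ← ENNReal.rpow_mul, ← ENNReal.rpow_mul] at hmain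
  have hexp : 1 / p' * r = 1 - 1 / γ := by
    rw [hγ, hp', hr]
    field_simp
    ring
  have hdiv : A ^ (1 / γ) ≤ ENNReal.ofReal γ ^ r * B ^ (1 / p * r) := by
    have h1 : A ^ (1 / γ) * A ^ (1 / p' * r)
        ≤ (ENNReal.ofReal γ ^ r * B ^ (1 / p * r)) * A ^ (1 / p' * r) := by
      rw [← ENNReal.rpow_add _ _ hA0 hAtop, hexp]
      rw [hexp] at hmain
      have : 1 / γ + (1 - 1 / γ) = 1 := by ring
      rw [this, ENNReal.rpow_one]
      refine hmain.trans_eq (by ring)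
    exact (ENNReal.mul_le_mul_iff_left
      (by simp [ENNReal.rpow_eq_zero_iff, hA0, hAtop])
      (ENNReal.rpow_ne_top_of_nonneg (by positivity) hAtop)).1 h1
  have hγ0 : 0 < γ := by linarith
  calc A = (A ^ (1 / γ)) ^ γ := by
        rw [← ENNReal.rpow_mul, one_div_mul_cancel hγ0.ne', ENNReal.rpow_one]
    _ ≤ (ENNReal.ofReal γ ^ r * B ^ (1 / p * r)) ^ γ := by gcongr
    _ = (ENNReal.ofReal γ ^ r) ^ γ * B ^ (N / (N - p)) := by
        rw [ENNReal.mul_rpow_of_nonneg _ _ hγ0.le, ← ENNReal.rpow_mul B]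
        congr 2
        rw [hγ, hr]
        field_simp

/-- For every `α > 0` and `λ > 0` there exist `R > 0` and `c > 0` such that
`I_α(u) ≥ c` for all `u ∈ W₀^{1,p}(Ω)` with `‖u‖ = R`. -/
theorem statement8 {N : ℕ} (Ω : Set (Eu N)) (hΩo : IsOpen Ω) (hΩne : Ω.Nonempty)
    (hΩb : Bornology.IsBounded Ω) (p q : ℝ) (hpq : ExponentsOK N p q)
    (g G : ℝ → ℝ) (hg : IsCutoff g) (hG : ∀ t, G t = ∫ s in (0:ℝ)..t, g s)
    (α : ℝ) (hα : 0 < α) (lam : ℝ) (hlam : 0 < lam) :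
    ∃ R > (0:ℝ), ∃ c > (0:ℝ), ∀ u : Eu N → ℝ, MemW01p Ω p u → wnorm Ω p u = R →
      c ≤ Ifun Ω p q lam α G u := by
  obtain ⟨hN, hp, hpq, hpN, hq⟩ := hpq
  obtain ⟨K, hK, hKS⟩ := exists_sobolev_const hN hp hpN
  have hNp : (0 : ℝ) < N - p := by linarith
  have hp0 : 0 < p := by linarith
  have hq0 : 0 < q := by linarith
  set s : ℝ := N * p / (N - p) with hs
  have hs0 : 0 < s := by linarith
  have hsp : 0 < s - p := by linarith
  set M : ℝ := lam * (K.toReal / q) + 1 with hM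
  have hM0 : 0 < M := by positivity
  set R : ℝ := (1 / (2 * p * M)) ^ (1 / (s - p)) with hR
  have hR0 : 0 < R := by positivity
  have hRs : M * R ^ s = R ^ p / (2 * p) := by
    have h1 : R ^ (s - p) = 1 / (2 * p * M) := by
      rw [hR, ← Real.rpow_mul (by positivity), one_div_mul_cancel hsp.ne', Real.rpow_one]
    have h2 : R ^ s = R ^ (s - p) * R ^ p := by
      rw [← Real.rpow_add hR0]
      congr 1
      ring
    rw [h2, h1]
    field_simp
  refine ⟨R, hR0, R ^ p / (2 * p), by positivity, ?_⟩
  rintro u ⟨hu, h0, hint⟩ hnorm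
  have hgrad : ∀ x, ‖gradient u x‖ = ‖fderiv ℝ u x‖ := fun x => by simp [gradient]
  have hB : ∫ x in Ω, ‖gradient u x‖ ^ p = R ^ p := by
    have h1 : 0 ≤ ∫ x in Ω, ‖gradient u x‖ ^ p := integral_nonneg fun x => by positivity
    rw [← hnorm, wnorm, ← Real.rpow_mul h1, one_div_mul_cancel hp0.ne', Real.rpow_one]
  have hB' : ∫⁻ x in Ω, ‖fderiv ℝ u x‖ₑ ^ p = ENNReal.ofReal (R ^ p) := by
    rw [← hB, ofReal_integral_eq_lintegral_ofReal hint (ae_of_all _ fun x => by positivity)]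
    refine lintegral_congr fun x => ?_
    rw [hgrad, ← ENNReal.ofReal_rpow_of_nonneg (norm_nonneg _) hp0.le, ofReal_norm]
  obtain ⟨hAtop, hA⟩ := hKS Ω hΩo hΩb u hu h0
  have hm : Continuous fun x => |u x| ^ s := hu.continuous.abs.rpow_const fun x => Or.inr hs0.le
  have hen : ∀ x, ‖u x‖ₑ ^ s = ENNReal.ofReal (|u x| ^ s) := fun x => by
    rw [← ENNReal.ofReal_rpow_of_nonneg (abs_nonneg _) hs0.le, Real.enorm_eq_ofReal_abs]
  have hAi : Integrable fun x => |u x| ^ s := by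
    refine ⟨hm.aestronglyMeasurable, ?_⟩
    rw [hasFiniteIntegral_iff_ofReal (ae_of_all _ fun x => by positivity)]
    simpa only [← hen] using lt_top_iff_ne_top.2 hAtop
  have hAle : ∫ x, |u x| ^ s ≤ K.toReal * R ^ s := by
    rw [integral_eq_lintegral_of_nonneg_ae (ae_of_all _ fun x => by positivity)
      hm.aestronglyMeasurable]
    simp only [← hen]
    rw [hB', ENNReal.ofReal_rpow_of_nonneg (by positivity) (by positivity),
      ← Real.rpow_mul hR0.le] at hA
    have h1 := ENNReal.toReal_mono (by finiteness) hA
    rw [ENNReal.toReal_mul, ENNReal.toReal_ofReal (by positivity)] at h1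
    refine h1.trans_eq ?_
    congr 2
    rw [hs]
    ring
  have hneg : ∫ x in Ω, (max (u x - 1) 0) ^ q / q ≤ K.toReal * R ^ s / q := by
    calc ∫ x in Ω, (max (u x - 1) 0) ^ q / q
        ≤ ∫ x in Ω, |u x| ^ s / q := by
          refine integral_mono_of_nonneg (ae_of_all _ fun x => by positivity)
            (hAi.div_const q).integrableOn (ae_of_all _ fun x => ?_)
          simp only
          gcongr ?_ / q
          rcases le_total (u x) 1 with h | h
          · rw [max_eq_right (by linarith), Real.zero_rpow hq0.ne']
            positivity
          · rw [max_eq_left (by linarith), abs_of_nonneg (by linarith)]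
            exact (Real.rpow_le_rpow (by linarith) (by linarith) hq0.le).trans
              (Real.rpow_le_rpow_of_exponent_le h hq.le)
      _ ≤ ∫ x, |u x| ^ s / q :=
          setIntegral_le_integral (hAi.div_const q) (ae_of_all _ fun x => by positivity)
      _ ≤ K.toReal * R ^ s / q := by
          rw [integral_div]
          gcongr
  have hGnn : 0 ≤ ∫ x in Ω, G ((u x - 1) / α) := by
    refine integral_nonneg fun x => ?_
    simp only [Pi.zero_apply]
    rw [hG]
    set t := (u x - 1) / α
    rcases le_total 0 t with h | h
    · exact intervalIntegral.integral_nonneg h fun y _ => (hg.2.1 y).1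
    · rw [intervalIntegral.integral_zero_ae]
      refine ae_of_all _ fun y hy => hg.2.2.1 y fun hy' => ?_
      rw [uIoc_of_ge h] at hy
      exact absurd hy.2 (not_le.2 hy'.1)
  have hRs0 : 0 < R ^ s := by positivity
  have hlneg := mul_le_mul_of_nonneg_left hneg hlam.le
  have hgr : ∫ x in Ω, ‖gradient u x‖ ^ p / p = R ^ p / p := by rw [integral_div, hB]
  have hsum : lam * (K.toReal * R ^ s / q) + R ^ s = R ^ p / (2 * p) := by
    rw [← hRs, hM]
    ring
  have hhalf : R ^ p / p = 2 * (R ^ p / (2 * p)) := by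
    field_simp
  rw [Ifun, hgr]
  linarith
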